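/- Let $M_n$ be the $n \times n$ random matrix whose entries are i.i.d. random variables taking values $+1$ and $-1$ each with probability $1/2$. Then $\mathbb{P}\Big(|\det M_n| \geq \sqrt{n!}\, \exp(-29\sqrt{n \log n})\Big) \to 1$ as $n \to \infty$. -/

import Mathlib

open Filter

open scoped BigOperators in
/-- The probability of the event `p` under the uniform distribution on a finite type. -/
noncomputable def unifProb {α : Type*} [Fintype α] (p : α → Prop) : ℝ :=
  Finset.expect Finset.univ fun a => Set.indicator {a | p a} (1 : α → ℝ) a

section Probability

open Finset
open scoped BigOperators

variable {α : Type*} [Fintype α]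

lemma unifProb_eq (p : α → Prop) :
    unifProb p = (Nat.card {a // p a} : ℝ) / Fintype.card α := by
  classical
  rw [unifProb, Fintype.expect_eq_sum_div_card, Nat.card_eq_fintype_card, Fintype.card_subtype]
  simp [Set.indicator_apply, Finset.sum_boole]

lemma unifProb_nonneg (p : α → Prop) : 0 ≤ unifProb p := by
  rw [unifProb_eq]; positivity

lemma unifProb_mono {p q : α → Prop} (h : ∀ a, p a → q a) : unifProb p ≤ unifProb q := by
  refine expect_le_expect fun a _ => ?_
  exact Set.indicator_le_indicator_of_subset (fun a ha => h a ha) (fun _ => zero_le_one) a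

lemma unifProb_or_le (p q : α → Prop) :
    unifProb (fun a => p a ∨ q a) ≤ unifProb p + unifProb q := by
  classical
  rw [unifProb, unifProb, unifProb, ← expect_add_distrib]
  refine expect_le_expect fun a _ => ?_
  by_cases hp : p a <;> by_cases hq : q a <;> simp [hp, hq]

lemma unifProb_exists_le {κ : Type*} (s : Finset κ) (p : κ → α → Prop) :
    unifProb (fun a => ∃ k ∈ s, p k a) ≤ ∑ k ∈ s, unifProb (p k) := by
  classical
  induction s using Finset.induction_on with
  | empty => simp [unifProb]
  | insert k s hk ih =>
    rw [sum_insert hk]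
    refine le_trans (unifProb_mono (q := fun a => p k a ∨ ∃ k ∈ s, p k a) ?_)
      ((unifProb_or_le _ _).trans (by gcongr))
    rintro a ⟨l, hl, hla⟩
    rcases Finset.mem_insert.1 hl with rfl | hl
    · exact Or.inl hla
    · exact Or.inr ⟨l, hl, hla⟩

lemma unifProb_not [Nonempty α] (p : α → Prop) :
    unifProb (fun a => ¬ p a) = 1 - unifProb p := by
  classical
  rw [eq_sub_iff_add_eq, unifProb, unifProb, ← expect_add_distrib]
  refine (expect_congr rfl fun a _ => ?_).trans (Fintype.expect_one (M := ℝ) (ι := α))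
  by_cases hp : p a <;> simp [hp]

lemma unifProb_markov (F : α → ℝ) (hF : ∀ a, 0 ≤ F a) {c : ℝ} (hc : 0 < c) :
    unifProb (fun a => c ≤ F a) ≤ (𝔼 a, F a) / c := by
  classical
  rw [le_div_iff₀ hc, unifProb, expect_mul]
  refine expect_le_expect fun a _ => ?_
  by_cases h : c ≤ F a
  · simp [h]
  · simp [h, hF]

lemma expect_resample {ι β : Type*} [Fintype ι] [DecidableEq ι] [Fintype β] [Nonempty β]
    (F : (ι → β) → ℝ) (i : ι) :
    𝔼 x, F x = 𝔼 x, 𝔼 b, F (Function.update x i b) := by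
  rw [← expect_product' univ univ (fun x b => F (Function.update x i b))]
  have h : 𝔼 x, F x = 𝔼 x : (ι → β), 𝔼 _b : β, F x := by simp
  rw [h, ← expect_product' univ univ (fun x (_ : β) => F x)]
  refine expect_equiv
    ⟨fun z => (Function.update z.1 i z.2, z.1 i), fun z => (Function.update z.1 i z.2, z.1 i),
      fun z => by simp, fun z => by simp⟩ (by simp) (fun z _ => by simp)

/-- If `q` does not depend on the `i`-th coordinate and `p` has conditional probability at most
`c` given the other coordinates on `q`, then `p ∧ q` has probability at most `c` times that of
`q`. -/
lemma unifProb_and_le {ι β : Type*} [Fintype ι] [DecidableEq ι] [Fintype β] [Nonempty β]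
    (i : ι) (p q : (ι → β) → Prop) (c : ℝ) (hq : ∀ x b, q (Function.update x i b) ↔ q x)
    (hp : ∀ x, q x → unifProb (fun b => p (Function.update x i b)) ≤ c) :
    unifProb (fun x => p x ∧ q x) ≤ c * unifProb q := by
  classical
  rw [unifProb, expect_resample _ i, unifProb, mul_expect]
  refine expect_le_expect fun x _ => ?_
  by_cases hx : q x
  · have := hp x hx
    simpa [unifProb, Set.indicator_apply, hq, hx] using this
  · simp [hq, hx]

lemma unifProb_pi {ι β : Type*} [Fintype ι] [DecidableEq ι] [Fintype β]
    (p : ι → β → Prop) :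
    unifProb (fun x : ι → β => ∀ i, p i (x i)) = ∏ i, unifProb (p i) := by
  classical
  simp only [unifProb_eq]
  rw [prod_div_distrib, Fintype.card_fun, Finset.prod_const, card_univ, Nat.cast_pow]
  congr 1
  rw [← Nat.cast_prod, ← Nat.card_pi]
  congr 1
  exact Nat.card_congr Equiv.subtypePiEquivPi

lemma unifProb_equiv {β : Type*} [Fintype β] (e : α ≃ β) (p : β → Prop) :
    unifProb (fun a => p (e a)) = unifProb p :=
  Fintype.expect_equiv e _ _ fun _ => rfl

end Probability

section Signs

open Finset
open scoped BigOperators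

/-- The sign `±1` encoded by a Boolean. -/
def boolSign (b : Bool) : ℝ := if b then 1 else -1

@[simp] lemma boolSign_true : boolSign true = 1 := rfl

@[simp] lemma boolSign_false : boolSign false = -1 := rfl

lemma boolSign_mul_self (b : Bool) : boolSign b * boolSign b = 1 := by cases b <;> simp

lemma abs_boolSign (b : Bool) : |boolSign b| = 1 := by cases b <;> simp

lemma expect_bool (f : Bool → ℝ) : 𝔼 b, f b = (f true + f false) / 2 := by
  rw [Fintype.expect_eq_sum_div_card]; simp

/-- The vector of signs encoded by a Boolean vector. -/
noncomputable def signVec {ι : Type*} (x : ι → Bool) : EuclideanSpace ℝ ι :=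
  WithLp.toLp 2 fun j => boolSign (x j)

@[simp] lemma signVec_apply {ι : Type*} (x : ι → Bool) (i : ι) : signVec x i = boolSign (x i) := rfl

variable {ι : Type*} [Fintype ι] [DecidableEq ι]

lemma expect_boolSign_mul (i : ι) (G : (ι → Bool) → ℝ)
    (hG : ∀ x b, G (Function.update x i b) = G x) :
    𝔼 x : ι → Bool, boolSign (x i) * G x = 0 := by
  rw [expect_resample _ i]
  simp only [hG, Function.update_self, expect_bool]
  simp

lemma expect_boolSign_four {i j : ι} (hij : i ≠ j) (k l : ι) :
    𝔼 x : ι → Bool, boolSign (x i) * boolSign (x j) * (boolSign (x k) * boolSign (x l)) =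
      (if k = i ∧ l = j then 1 else 0) + (if k = j ∧ l = i then 1 else 0) := by
  have one : ∀ i j : ι, 𝔼 x : ι → Bool,
      boolSign (x i) * boolSign (x j) * (boolSign (x i) * boolSign (x j)) = 1 := fun i j => by
    refine (expect_congr rfl fun x _ => ?_).trans (Fintype.expect_one (M := ℝ))
    rw [mul_mul_mul_comm, boolSign_mul_self, boolSign_mul_self, one_mul]
  have zero : ∀ i j k : ι, i ≠ j → i ≠ k → ∀ l, i ≠ l → 𝔼 x : ι → Bool,
      boolSign (x i) * (boolSign (x j) * (boolSign (x k) * boolSign (x l))) = 0 :=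
    fun i j k h1 h2 l h3 => expect_boolSign_mul i _ fun x b => by
      simp [Function.update_of_ne h1.symm, Function.update_of_ne h2.symm,
        Function.update_of_ne h3.symm]
  by_cases hki : k = i
  · subst hki
    by_cases hlj : l = j
    · subst hlj
      rw [one]; simp [hij]
    · have := zero j k k hij.symm hij.symm l (Ne.symm hlj)
      simp only [hlj, and_false, if_false, hij, false_and, add_zero]
      rw [← this]
      exact expect_congr rfl fun x _ => by ring
  · by_cases hli : l = i
    · subst hli
      by_cases hkj : k = j
      · subst hkj
        simp only [hki, false_and, if_false, and_self, if_true, zero_add]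
        rw [← one l k]
        exact expect_congr rfl fun x _ => by ring
      · have := zero j l k hij.symm (Ne.symm hkj) l hij.symm
        simp only [hki, hkj, false_and, if_false, add_zero]
        rw [← this]
        exact expect_congr rfl fun x _ => by ring
    · have := zero i j k hij (Ne.symm hki) l (Ne.symm hli)
      simp only [hki, hli, false_and, and_false, if_false, add_zero]
      rw [← this]
      exact expect_congr rfl fun x _ => by ring

lemma expect_quadratic_form_sub_trace_sq_le (P : ι → ι → ℝ) (hP : ∀ i j, P i j = P j i) :
    𝔼 x : ι → Bool, (∑ i, ∑ j, P i j * (boolSign (x i) * boolSign (x j)) - ∑ i, P i i) ^ 2 ≤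
      2 * ∑ i, ∑ j, P i j ^ 2 := by
  set a : ι → ι → ℝ := fun i j => if i = j then 0 else P i j with ha
  have hsum : ∀ x : ι → Bool,
      ∑ i, ∑ j, P i j * (boolSign (x i) * boolSign (x j)) - ∑ i, P i i =
        ∑ i, ∑ j, a i j * (boolSign (x i) * boolSign (x j)) := fun x => by
    rw [← sum_sub_distrib]
    refine sum_congr rfl fun i _ => ?_
    rw [← add_sum_erase _ _ (mem_univ i), ← add_sum_erase univ (fun j => a i j * _) (mem_univ i)]
    have : ∑ j ∈ univ.erase i, a i j * (boolSign (x i) * boolSign (x j)) =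
        ∑ j ∈ univ.erase i, P i j * (boolSign (x i) * boolSign (x j)) :=
      sum_congr rfl fun j hj => by simp [ha, (ne_of_mem_erase hj).symm]
    rw [this, boolSign_mul_self]
    simp [ha]
  have hsq : ∀ x : ι → Bool, (∑ i, ∑ j, a i j * (boolSign (x i) * boolSign (x j))) ^ 2 =
      ∑ i, ∑ j, ∑ k, ∑ l, a i j * a k l *
        (boolSign (x i) * boolSign (x j) * (boolSign (x k) * boolSign (x l))) := fun x => by
    rw [sq]
    simp only [sum_mul, mul_sum]
    refine sum_congr rfl fun i _ => sum_congr rfl fun j _ => sum_congr rfl fun k _ =>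
      sum_congr rfl fun l _ => by ring
  simp only [hsum, hsq, expect_sum_comm, ← mul_expect]
  have key : ∀ i j k l, a i j * a k l * (𝔼 x : ι → Bool,
      (boolSign (x i) * boolSign (x j) * (boolSign (x k) * boolSign (x l)))) =
      (if k = i then if l = j then a i j * a k l else 0 else 0) +
        (if k = j then if l = i then a i j * a k l else 0 else 0) := fun i j k l => by
    by_cases hij : i = j
    · simp [ha, hij]
    rw [expect_boolSign_four hij]
    by_cases h1 : k = i <;> by_cases h2 : l = j <;> by_cases h3 : k = j <;>
      by_cases h4 : l = i <;> simp [h1, h2, h3, h4] <;> simp_all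
  simp only [key, sum_add_distrib]
  simp only [sum_ite_eq', mem_univ, if_true, sum_ite_irrel, sum_const_zero]
  have hs : ∀ i j, a j i = a i j := fun i j => by simp [ha, hP j i, eq_comm]
  rw [← sum_add_distrib, mul_sum]
  refine sum_le_sum fun i _ => ?_
  rw [← sum_add_distrib, mul_sum]
  refine sum_le_sum fun j _ => ?_
  rw [hs i j]
  by_cases hij : i = j
  · simp [ha, hij]; positivity
  · simp [ha, hij]; linarith [sq (P i j)]

lemma norm_starProjection_signVec_sq (U : Submodule ℝ (EuclideanSpace ℝ ι)) (x : ι → Bool) :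
    ‖U.starProjection (signVec x)‖ ^ 2 = ∑ i, ∑ j,
      inner ℝ (EuclideanSpace.single i (1 : ℝ)) (U.starProjection (EuclideanSpace.single j 1)) *
        (boolSign (x i) * boolSign (x j)) := by
  have hx : signVec x = ∑ i, boolSign (x i) • EuclideanSpace.single i (1 : ℝ) := by
    ext k
    simp [Finset.sum_apply, Pi.single_apply]
  have h1 : ‖U.starProjection (signVec x)‖ ^ 2 =
      inner ℝ (signVec x) (U.starProjection (signVec x)) := by
    rw [← real_inner_self_eq_norm_sq, Submodule.inner_starProjection_left_eq_right,
      Submodule.starProjection_eq_self_iff.2 (Submodule.starProjection_apply_mem _ _)]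
  rw [h1, hx, sum_inner]
  refine sum_congr rfl fun i _ => ?_
  rw [map_sum, inner_sum]
  refine sum_congr rfl fun j _ => ?_
  rw [map_smul, inner_smul_left, inner_smul_right]
  simp; ring

lemma expect_norm_starProjection_signVec_le (U : Submodule ℝ (EuclideanSpace ℝ ι)) :
    𝔼 x : ι → Bool, (‖U.starProjection (signVec x)‖ ^ 2 - Module.finrank ℝ U) ^ 2 ≤
      2 * Module.finrank ℝ U := by
  set e : ι → EuclideanSpace ℝ ι := fun i => EuclideanSpace.single i (1 : ℝ) with he
  have htr : ∑ i, inner ℝ (e i) (U.starProjection (e i)) = (Module.finrank ℝ U : ℝ) := by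
    have h := (U.starProjection : EuclideanSpace ℝ ι →ₗ[ℝ] EuclideanSpace ℝ ι).trace_eq_sum_inner
      (EuclideanSpace.basisFun ι ℝ)
    simp only [EuclideanSpace.basisFun_apply] at h
    refine Eq.trans h.symm ?_
    apply LinearMap.IsProj.trace (p := U)
    exact ⟨fun x => Submodule.starProjection_apply_mem _ _,
      fun x hx => Submodule.starProjection_eq_self_iff.2 hx⟩
  have hsq : ∑ i, ∑ j, (inner ℝ (e i) (U.starProjection (e j))) ^ 2 =
      (Module.finrank ℝ U : ℝ) := by
    rw [sum_comm, ← htr]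
    refine sum_congr rfl fun j _ => ?_
    have := (EuclideanSpace.basisFun ι ℝ).sum_sq_norm_inner_right (U.starProjection (e j))
    simp only [EuclideanSpace.basisFun_apply, Real.norm_eq_abs, sq_abs] at this
    rw [this, ← real_inner_self_eq_norm_sq, Submodule.inner_starProjection_left_eq_right,
      Submodule.starProjection_eq_self_iff.2 (Submodule.starProjection_apply_mem _ _)]
  have h := expect_quadratic_form_sub_trace_sq_le
    (fun i j => inner ℝ (e i) (U.starProjection (e j)))
    (fun i j => by rw [real_inner_comm, Submodule.inner_starProjection_left_eq_right])
  simp only [hsq, htr] at h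
  simpa only [norm_starProjection_signVec_sq] using h

end Signs

section SmallBall

open Finset
open scoped BigOperators

variable {ι : Type*} [Fintype ι]

lemma inner_signVec (u : EuclideanSpace ℝ ι) (x : ι → Bool) :
    inner ℝ u (signVec x) = ∑ j, u j * boolSign (x j) := by
  rw [PiLp.inner_apply]
  exact sum_congr rfl fun j _ => by simp [mul_comm]

lemma exists_mem_sup_normalized {U : Submodule ℝ (EuclideanSpace ℝ ι)} (hU : U ≠ ⊥) :
    ∃ u ∈ U, ∃ i, u i = 1 ∧ ∀ j, |u j| ≤ 1 := by
  obtain ⟨v, hvU, hv⟩ := Submodule.exists_mem_ne_zero_of_ne_bot hU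
  have hne : ∃ j, v j ≠ 0 := by
    by_contra! h
    exact hv (by ext j; simpa using h j)
  obtain ⟨j₀, hj₀⟩ := hne
  obtain ⟨i, -, hi⟩ := exists_max_image univ (fun j => |v j|) ⟨j₀, mem_univ _⟩
  have hvi : 0 < |v i| := (abs_pos.2 hj₀).trans_le (hi j₀ (mem_univ _))
  refine ⟨(v i)⁻¹ • v, U.smul_mem _ hvU, i, ?_, fun j => ?_⟩
  · simp [inv_mul_cancel₀ (abs_pos.1 hvi)]
  · rw [PiLp.smul_apply, smul_eq_mul, abs_mul, abs_inv, inv_mul_le_iff₀ hvi, mul_one]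
    exact hi j (mem_univ _)

variable [DecidableEq ι]

lemma unifProb_boolSign_le_half (c : ℝ) : unifProb (fun b => |c + boolSign b| < 1) ≤ 1 / 2 := by
  classical
  rw [unifProb, expect_bool]
  simp only [Set.indicator_apply, Set.mem_ofPred_eq, boolSign_true, boolSign_false, Pi.one_apply]
  by_cases h1 : |c + 1| < 1 <;> by_cases h2 : |c + -1| < 1 <;> simp only [h1, h2] <;> norm_num
  rw [abs_lt] at h1 h2
  linarith

/-- A robust form of Odlyzko's bound for the probability that a random sign vector is close to the
orthogonal complement of a subspace of dimension at least `k`. -/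
lemma unifProb_forall_abs_inner_lt_le (k : ℕ) (U : Submodule ℝ (EuclideanSpace ℝ ι))
    (hk : k ≤ Module.finrank ℝ U) :
    unifProb (fun x : ι → Bool => ∀ u ∈ U, ∀ i, u i = 1 → (∀ j, |u j| ≤ 1) →
      |inner ℝ u (signVec x)| < 1) ≤ (1 / 2) ^ k := by
  induction k generalizing U with
  | zero =>
    refine (unifProb_mono (q := fun _ => True) fun _ _ => trivial).trans ?_
    simp [unifProb]
  | succ k ih =>
    have hU : U ≠ ⊥ := by
      rintro rfl
      simp at hk
    obtain ⟨u, huU, i, hui, hu⟩ := exists_mem_sup_normalized hU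
    set f : U →ₗ[ℝ] ℝ := (EuclideanSpace.proj i : EuclideanSpace ℝ ι →L[ℝ] ℝ).toLinearMap.comp
      U.subtype with hf
    set U' : Submodule ℝ (EuclideanSpace ℝ ι) := (LinearMap.ker f).map U.subtype with hU'
    have hU'U : U' ≤ U := Submodule.map_subtype_le _ _
    have hzero : ∀ v ∈ U', v i = 0 := by
      rintro v ⟨w, hw, rfl⟩
      simpa [hf] using hw
    have hdim : k ≤ Module.finrank ℝ U' := by
      have h1 : Module.finrank ℝ U' = Module.finrank ℝ (LinearMap.ker f) :=
        Submodule.finrank_map_subtype_eq _ _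
      have h2 := f.finrank_range_add_finrank_ker
      have h3 : Module.finrank ℝ (LinearMap.range f) ≤ 1 :=
        (Submodule.finrank_le _).trans (by simp)
      omega
    refine le_trans (unifProb_mono (q := fun x => |inner ℝ u (signVec x)| < 1 ∧
      ∀ u ∈ U', ∀ i, u i = 1 → (∀ j, |u j| ≤ 1) → |inner ℝ u (signVec x)| < 1)
      fun x hx => ⟨hx u huU i hui hu, fun v hv => hx v (hU'U hv)⟩) ?_
    refine (unifProb_and_le i _ _ (1 / 2) (fun x b => ?_) fun x _ => ?_).trans ?_
    · refine forall₂_congr fun v hv => ?_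
      have : inner ℝ v (signVec (Function.update x i b)) = inner ℝ v (signVec x) := by
        rw [inner_signVec, inner_signVec]
        refine sum_congr rfl fun j _ => ?_
        by_cases hj : j = i
        · subst hj; simp [hzero v hv]
        · simp [Function.update_of_ne hj]
      rw [this]
    · have : ∀ b, inner ℝ u (signVec (Function.update x i b)) =
          ∑ j ∈ univ.erase i, u j * boolSign (x j) + boolSign b := fun b => by
        rw [inner_signVec, ← sum_erase_add _ _ (mem_univ i)]
        congr 1
        · exact sum_congr rfl fun j hj => by rw [Function.update_of_ne (ne_of_mem_erase hj)]
        · simp [hui]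
      simp only [this]
      exact unifProb_boolSign_le_half _
    · rw [pow_succ']
      gcongr
      exact ih U' hdim

lemma unifProb_prod_le {α β : Type*} [Fintype α] [Fintype β] [Nonempty β] (p : α × β → Prop)
    (c : ℝ) (h : ∀ b, unifProb (fun a => p (a, b)) ≤ c) : unifProb p ≤ c := by
  rw [unifProb, ← univ_product_univ, expect_product, expect_comm]
  calc _ ≤ 𝔼 _b : β, c := expect_le_expect fun b _ => h b
    _ = c := Fintype.expect_const c

/-- **Erdős–Littlewood–Offord inequality**, all coefficients being at least `δ` in absolute
value. -/
lemma unifProb_abs_add_sum_lt_le (v : ι → ℝ) {δ : ℝ} (hv : ∀ t, δ ≤ |v t|) (c : ℝ) :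
    unifProb (fun y : ι → Bool => |c + ∑ t, v t * boolSign (y t)| < δ) ≤
      ((Fintype.card ι).choose (Fintype.card ι / 2) : ℝ) / 2 ^ Fintype.card ι := by
  classical
  set g : Finset ι → ℝ := fun A => c + ∑ t, |v t| * (if t ∈ A then 1 else -1) with hg
  set 𝒜 : Finset (Finset ι) := univ.filter fun A => |g A| < δ with h𝒜
  have hanti : IsAntichain (· ⊆ ·) (𝒜 : Set (Finset ι)) := by
    intro A hA B hB hne hAB
    obtain ⟨t, htB, htA⟩ := Finset.exists_of_ssubset (hAB.ssubset_of_ne hne)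
    have hdiff : 2 * |v t| ≤ g B - g A := by
      have : g B - g A =
          ∑ s, |v s| * ((if s ∈ B then 1 else -1) - (if s ∈ A then 1 else -1)) := by
        simp only [hg, mul_sub, sum_sub_distrib]; ring
      rw [this]
      refine le_trans ?_ (single_le_sum (fun s _ => ?_) (mem_univ t))
      · simp only [htB, htA, if_true, if_false]; linarith
      · by_cases hsA : s ∈ A
        · simp [hsA, hAB hsA]
        · by_cases hsB : s ∈ B <;> simp [hsA, hsB]
    have h1 : |g A| < δ := by simpa [h𝒜] using hA
    have h2 : |g B| < δ := by simpa [h𝒜] using hB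
    rw [abs_lt] at h1 h2
    linarith [hv t]
  have hcard : Nat.card {y : ι → Bool // |c + ∑ t, v t * boolSign (y t)| < δ} ≤ #𝒜 := by
    rw [Nat.card_eq_fintype_card, Fintype.card_subtype]
    refine card_le_card_of_injOn (fun y => univ.filter fun t => y t = decide (0 < v t)) ?_ ?_
    · intro y hy
      have hy' : |c + ∑ t, v t * boolSign (y t)| < δ := by simpa using hy
      have : g (univ.filter fun t => y t = decide (0 < v t)) =
          c + ∑ t, v t * boolSign (y t) := by
        simp only [hg]
        congr 1
        refine sum_congr rfl fun t _ => ?_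
        by_cases h : 0 < v t
        · cases hyt : y t <;> simp [h, hyt, abs_of_pos h]
        · cases hyt : y t <;> simp [h, hyt, abs_of_nonpos (not_lt.1 h)]
      simpa [h𝒜, this] using hy'
    · intro y _ y' _ h
      ext1 t
      have : (y t = decide (0 < v t)) ↔ (y' t = decide (0 < v t)) := by
        have := Finset.ext_iff.1 h t
        simpa using this
      revert this
      cases y t <;> cases y' t <;> cases decide (0 < v t) <;> simp
  rw [unifProb_eq]
  simp only [Fintype.card_fun, Fintype.card_bool, Nat.cast_pow, Nat.cast_ofNat]
  gcongr
  exact hcard.trans hanti.sperner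

lemma unifProb_abs_inner_signVec_lt_le (u : EuclideanSpace ℝ ι) {δ : ℝ} {m : ℕ}
    (hm : m ≤ #{j | δ ≤ |u j|}) :
    unifProb (fun x : ι → Bool => |inner ℝ u (signVec x)| < δ) ≤
      (m.choose (m / 2) : ℝ) / 2 ^ m := by
  classical
  obtain ⟨T, hT, hTm⟩ := Finset.exists_subset_card_eq hm
  rw [← unifProb_equiv (Equiv.piEquivPiSubtypeProd (· ∈ T) fun _ => Bool).symm]
  refine unifProb_prod_le _ _ fun z => ?_
  have := unifProb_abs_add_sum_lt_le (ι := {i // i ∈ T}) (fun t => u t) (δ := δ)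
    (fun t => by simpa using hT t.2) (∑ t : {i // i ∉ T}, u t * boolSign (z t))
  rw [Fintype.card_coe, hTm] at this
  refine (unifProb_mono fun y hy => ?_).trans this
  rw [inner_signVec, ← Fintype.sum_subtype_add_sum_subtype (· ∈ T)] at hy
  rw [add_comm]
  convert hy using 5 with t _ t _
  · simp [Equiv.piEquivPiSubtypeProd, t.2]
  · simp [Equiv.piEquivPiSubtypeProd, t.2]

lemma unifProb_forall_eq {m : ℕ} (f : Fin m ↪ ι) (τ : Fin m → Bool) :
    unifProb (fun y : ι → Bool => ∀ a, y (f a) = τ a) = (1 / 2) ^ m := by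
  classical
  have h : (fun y : ι → Bool => ∀ a, y (f a) = τ a) =
      fun y => ∀ j, (fun j b => ∀ a, f a = j → b = τ a) j (y j) := by
    funext y
    exact propext ⟨fun h j a ha => ha ▸ h a, fun h a => h _ a rfl⟩
  rw [h, unifProb_pi fun j b => ∀ a, f a = j → b = τ a]
  have h2 : ∀ j, unifProb (fun b => ∀ a, f a = j → b = τ a) =
      if j ∈ univ.map f then 1 / 2 else 1 := fun j => by
    split_ifs with hj
    · obtain ⟨a, -, rfl⟩ := Finset.mem_map.1 hj
      simp only [f.injective.eq_iff, forall_eq, unifProb, expect_bool]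
      cases τ a <;> simp
    · have : ∀ a, f a ≠ j := fun a ha => hj (Finset.mem_map.2 ⟨a, mem_univ _, ha⟩)
      simp [this, unifProb]
  simp only [h2, prod_ite_mem, univ_inter, prod_const, card_map, card_univ, Fintype.card_fin]

/-- The event that every sign pattern on every set of `m` columns occurs in some row of `R`. -/
def AllPatterns {κ ι : Type*} (R : Finset κ) (m : ℕ) (M : κ → ι → Bool) : Prop :=
  ∀ (f : Fin m ↪ ι) (τ : Fin m → Bool), ∃ i ∈ R, ∀ a, M i (f a) = τ a

lemma unifProb_not_allPatterns_le {κ : Type*} [Fintype κ] [DecidableEq κ] (R : Finset κ) (m : ℕ) :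
    unifProb (fun M : κ → ι → Bool => ¬ AllPatterns R m M) ≤
      (Fintype.card ι : ℝ) ^ m * 2 ^ m * (1 - (1 / 2) ^ m) ^ #R := by
  classical
  have hfix : ∀ (f : Fin m ↪ ι) (τ : Fin m → Bool),
      unifProb (fun M : κ → ι → Bool => ∀ i ∈ R, ¬ ∀ a, M i (f a) = τ a) =
        (1 - (1 / 2) ^ m) ^ #R := fun f τ => by
    rw [unifProb_pi (fun i (y : ι → Bool) => i ∈ R → ¬ ∀ a, y (f a) = τ a)]
    have : ∀ i, unifProb (fun y : ι → Bool => i ∈ R → ¬ ∀ a, y (f a) = τ a) =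
        if i ∈ R then 1 - (1 / 2) ^ m else 1 := fun i => by
      split_ifs with hi
      · simp only [hi, forall_true_left]
        rw [unifProb_not, unifProb_forall_eq]
      · simp [hi, unifProb]
    simp only [this, prod_ite_mem, univ_inter, prod_const]
  calc _ ≤ unifProb (fun M : κ → ι → Bool => ∃ z ∈ (univ : Finset ((Fin m ↪ ι) × (Fin m → Bool))),
        ∀ i ∈ R, ¬ ∀ a, M i (z.1 a) = z.2 a) := by
        refine unifProb_mono fun M hM => ?_
        simp only [AllPatterns] at hM
        push Not at hM
        obtain ⟨f, τ, h⟩ := hM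
        refine ⟨(f, τ), mem_univ _, fun i hi => ?_⟩
        push Not
        exact h i hi
    _ ≤ ∑ z : (Fin m ↪ ι) × (Fin m → Bool), (1 - (1 / 2 : ℝ) ^ m) ^ #R := by
        refine (unifProb_exists_le _ _).trans (sum_le_sum fun z _ => (hfix z.1 z.2).le)
    _ ≤ _ := by
        rw [sum_const, card_univ, Fintype.card_prod, nsmul_eq_mul, Fintype.card_embedding_eq,
          Fintype.card_fun, Fintype.card_bool, Fintype.card_fin]
        push_cast
        have h1 : ((Fintype.card ι).descFactorial m : ℝ) ≤ (Fintype.card ι : ℝ) ^ m := by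
          exact_mod_cast Nat.descFactorial_le_pow _ _
        have h2 : (0 : ℝ) ≤ 1 - (1 / 2) ^ m :=
          sub_nonneg.2 (pow_le_one₀ (by norm_num) (by norm_num))
        gcongr

lemma AllPatterns.le_card {κ : Type*} {R : Finset κ} {m : ℕ} {M : κ → ι → Bool}
    (h : AllPatterns R m M) (hm : m ≤ Fintype.card ι) {u : EuclideanSpace ℝ ι}
    (horth : ∀ i ∈ R, inner ℝ u (signVec (M i)) = 0) {i₀ : ι} (hi₀ : u i₀ = 1) :
    m ≤ #{j | 1 / (2 * (Fintype.card ι : ℝ)) ≤ |u j|} := by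
  classical
  by_contra! hlt
  set N : ℝ := ((Fintype.card ι : ℕ) : ℝ) with hN
  have hN1 : 1 ≤ N := by
    have : 0 < Fintype.card ι := Fintype.card_pos_iff.2 ⟨i₀⟩
    rw [hN]; exact_mod_cast this
  obtain ⟨S, hTS, -, hS⟩ := exists_subsuperset_card_eq (subset_univ _) hlt.le
    (by simpa using hm)
  set e := S.equivFin.symm.trans (Equiv.refl _) with he
  subst hS
  obtain ⟨i, hiR, hi⟩ := h (e.toEmbedding.trans (Function.Embedding.subtype _))
    (fun a => decide (0 < u (e a)))
  have hsgn : ∀ j ∈ S, u j * boolSign (M i j) = |u j| := fun j hj => by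
    have := hi (e.symm ⟨j, hj⟩)
    simp at this
    rw [this]
    by_cases h0 : 0 < u j
    · simp [h0, abs_of_pos h0]
    · simp [h0, abs_of_nonpos (not_lt.1 h0)]
  have hi₀S : i₀ ∈ S := hTS (by
    simp only [mem_filter, mem_univ, true_and, hi₀, abs_one]
    rw [div_le_one (by linarith)]; linarith)
  have h0 := horth i hiR
  rw [inner_signVec, ← sum_add_sum_compl S, sum_congr rfl hsgn] at h0
  have h1 : 1 ≤ ∑ j ∈ S, |u j| := by
    refine le_trans ?_ (single_le_sum (fun j _ => abs_nonneg (u j)) hi₀S)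
    simp [hi₀]
  have h2 : |∑ j ∈ Sᶜ, u j * boolSign (M i j)| ≤ 1 / 2 := by
    refine (abs_sum_le_sum_abs _ _).trans ?_
    calc _ ≤ ∑ j ∈ Sᶜ, 1 / (2 * N) := by
          refine sum_le_sum fun j hj => ?_
          rw [abs_mul, abs_boolSign, mul_one]
          have : j ∉ S := by simpa using hj
          by_contra! hc
          exact this (hTS (by simpa using hc.le))
      _ ≤ N * (1 / (2 * N)) := by
          rw [sum_const, nsmul_eq_mul]
          gcongr
          exact Nat.cast_le.2 (card_le_univ _)
      _ = 1 / 2 := by field_simp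
  rw [abs_le] at h2
  linarith

end SmallBall

section Distances

open Finset
open scoped BigOperators

lemma gramSchmidt_eq_starProjection {E : Type*} [NormedAddCommGroup E] [InnerProductSpace ℝ E]
    [FiniteDimensional ℝ E] {n : ℕ} (f : Fin n → E) (i : Fin n) :
    InnerProductSpace.gramSchmidt ℝ f i =
      (Submodule.span ℝ (f '' Set.Iio i))ᗮ.starProjection (f i) := by
  symm
  rw [← InnerProductSpace.span_gramSchmidt_Iio]
  apply Submodule.eq_starProjection_of_mem_orthogonal
  · rw [Submodule.mem_orthogonal]
    intro u hu
    induction hu using Submodule.span_induction with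
    | mem x hx =>
      obtain ⟨j, hj, rfl⟩ := hx
      exact InnerProductSpace.gramSchmidt_orthogonal ℝ f (ne_of_lt hj)
    | zero => simp
    | add x y _ _ hx hy => rw [inner_add_left, hx, hy, add_zero]
    | smul c x _ hx => rw [inner_smul_left, hx, mul_zero]
  · apply Submodule.le_orthogonal_orthogonal
    rw [InnerProductSpace.gramSchmidt_def, sub_sub_cancel]
    refine Submodule.sum_mem _ fun j hj => ?_
    rw [Submodule.starProjection_singleton]
    exact Submodule.smul_mem _ _ (Submodule.subset_span ⟨j, by simpa using hj, rfl⟩)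

/-- The square of a determinant is the product of the squared distances from each row to the span
of the preceding ones. -/
lemma det_sq_eq_prod_norm_starProjection_sq {n : ℕ} (f : Fin n → EuclideanSpace ℝ (Fin n)) :
    (Matrix.of fun i j => f i j).det ^ 2 =
      ∏ i, ‖(Submodule.span ℝ (f '' Set.Iio i))ᗮ.starProjection (f i)‖ ^ 2 := by
  simp only [← gramSchmidt_eq_starProjection]
  set g := InnerProductSpace.gramSchmidt ℝ f with hg
  set G : Matrix (Fin n) (Fin n) ℝ := Matrix.of fun i j => g i j with hG
  set L : Matrix (Fin n) (Fin n) ℝ := Matrix.of fun i j =>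
    if i = j then 1 else if j < i then inner ℝ (g j) (f i) / ‖g j‖ ^ 2 else 0 with hL
  have hFL : (Matrix.of fun i j => f i j) = L * G := by
    ext i j
    have h := congrArg (fun v : EuclideanSpace ℝ (Fin n) => v j)
      (InnerProductSpace.gramSchmidt_def'' ℝ f i)
    simp only [PiLp.add_apply, WithLp.ofLp_sum, Finset.sum_apply, PiLp.smul_apply,
      smul_eq_mul, RCLike.ofReal_real_eq_id, id] at h
    rw [Matrix.of_apply, h, Matrix.mul_apply, ← add_sum_erase _ _ (mem_univ i)]
    congr 1
    · simp [hL, hG, hg]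
    · have hsub : Iio i ⊆ univ.erase i := fun k hk => by
        simpa using (ne_of_lt (mem_Iio.1 hk))
      rw [← sum_subset hsub]
      · refine sum_congr rfl fun k hk => ?_
        have hk' := mem_Iio.1 hk
        simp [hL, hG, hg, hk', hk'.ne']
      · intro k hk hk'
        have h1 : i ≠ k := (ne_of_mem_erase hk).symm
        have h2 : ¬ k < i := fun h => hk' (mem_Iio.2 h)
        simp [hL, h1, h2]
  have hLdet : L.det = 1 := by
    rw [Matrix.det_of_isLowerTriangular]
    · simp [hL]
    · intro i j hij
      have hij' : i < j := hij
      simp [hL, hij'.ne, hij'.not_gt]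
  have hGG : G * G.transpose = Matrix.diagonal fun i => ‖g i‖ ^ 2 := by
    ext i j
    have h : (G * G.transpose) i j = inner ℝ (g i) (g j) := by
      rw [Matrix.mul_apply, PiLp.inner_apply]
      exact sum_congr rfl fun k _ => by simp [hG, mul_comm]
    rw [h]
    by_cases hij : i = j
    · subst hij; simp
    · rw [Matrix.diagonal_apply_ne _ hij, hg, InnerProductSpace.gramSchmidt_orthogonal ℝ f hij]
  rw [hFL, Matrix.det_mul, hLdet, one_mul, ← Matrix.det_diagonal, ← hGG, Matrix.det_mul,
    Matrix.det_transpose, sq]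

variable {n : ℕ}

/-- The orthogonal complement of the span of the rows preceding row `i`. -/
noncomputable def rowPerp (M : Fin n → Fin n → Bool) (i : Fin n) :
    Submodule ℝ (EuclideanSpace ℝ (Fin n)) :=
  (Submodule.span ℝ ((fun j => signVec (M j)) '' Set.Iio i))ᗮ

/-- The squared distance from row `i` to the span of the preceding rows. -/
noncomputable def sqDist (M : Fin n → Fin n → Bool) (i : Fin n) : ℝ :=
  ‖(rowPerp M i).starProjection (signVec (M i))‖ ^ 2

lemma det_sq_eq_prod_sqDist (M : Fin n → Fin n → Bool) :
    (Matrix.of fun i j => if M i j then (1 : ℝ) else -1).det ^ 2 = ∏ i, sqDist M i :=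
  det_sq_eq_prod_norm_starProjection_sq fun i => signVec (M i)

lemma rowPerp_update (M : Fin n → Fin n → Bool) (i : Fin n) (b : Fin n → Bool) :
    rowPerp (Function.update M i b) i = rowPerp M i := by
  unfold rowPerp
  congr 2
  refine Set.image_congr fun j hj => ?_
  rw [Function.update_of_ne (ne_of_lt hj)]

lemma finrank_rowPerp_update (M : Fin n → Fin n → Bool) (i : Fin n) (b : Fin n → Bool) :
    Module.finrank ℝ (rowPerp (Function.update M i b) i) = Module.finrank ℝ (rowPerp M i) := by
  rw [rowPerp_update]

lemma sqDist_update (M : Fin n → Fin n → Bool) (i : Fin n) (b : Fin n → Bool) :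
    sqDist (Function.update M i b) i = ‖(rowPerp M i).starProjection (signVec b)‖ ^ 2 := by
  simp only [sqDist, rowPerp_update, Function.update_self]

lemma le_finrank_rowPerp (M : Fin n → Fin n → Bool) (i : Fin n) :
    n - i ≤ Module.finrank ℝ (rowPerp M i) := by
  classical
  have h1 := Submodule.finrank_add_finrank_orthogonal
    (Submodule.span ℝ ((fun j => signVec (M j)) '' Set.Iio i))
  have h2 : Module.finrank ℝ (Submodule.span ℝ ((fun j => signVec (M j)) '' Set.Iio i)) ≤ i := by
    have := finrank_span_finset_le_card (R := ℝ) ((Finset.Iio i).image fun j => signVec (M j))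
    rw [coe_image, coe_Iio] at this
    refine this.trans (card_image_le.trans ?_)
    simp
  rw [finrank_euclideanSpace_fin] at h1
  unfold rowPerp
  omega

lemma finrank_rowPerp_le (M : Fin n → Fin n → Bool) (i : Fin n) :
    Module.finrank ℝ (rowPerp M i) ≤ n := by
  simpa using (rowPerp M i).finrank_le

lemma finrank_rowPerp_pos (M : Fin n → Fin n → Bool) (i : Fin n) :
    0 < Module.finrank ℝ (rowPerp M i) :=
  lt_of_lt_of_le (by omega) (le_finrank_rowPerp M i)

lemma inner_signVec_sq_le {U : Submodule ℝ (EuclideanSpace ℝ (Fin n))}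
    {u : EuclideanSpace ℝ (Fin n)} (hu : u ∈ U) (hu1 : ∀ j, |u j| ≤ 1) (x : Fin n → Bool) :
    (inner ℝ u (signVec x)) ^ 2 ≤ n * ‖U.starProjection (signVec x)‖ ^ 2 := by
  have h1 : inner ℝ u (signVec x) = inner ℝ u (U.starProjection (signVec x)) := by
    rw [← Submodule.inner_starProjection_left_eq_right, Submodule.starProjection_eq_self_iff.2 hu]
  have h2 : ‖u‖ ^ 2 ≤ n := by
    rw [EuclideanSpace.norm_sq_eq]
    calc _ ≤ ∑ _j : Fin n, (1 : ℝ) := sum_le_sum fun j _ => by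
          rw [Real.norm_eq_abs]; exact pow_le_one₀ (abs_nonneg _) (hu1 j)
      _ = n := by simp
  rw [h1, ← sq_abs]
  calc _ ≤ (‖u‖ * ‖U.starProjection (signVec x)‖) ^ 2 := by
        gcongr; exact abs_real_inner_le_norm _ _
    _ = ‖u‖ ^ 2 * ‖U.starProjection (signVec x)‖ ^ 2 := mul_pow _ _ _
    _ ≤ _ := by gcongr

lemma unifProb_sqDist_lt_le (i : Fin n) :
    unifProb (fun M : Fin n → Fin n → Bool => n * sqDist M i < 1) ≤ (1 / 2) ^ (n - i : ℕ) := by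
  have h := unifProb_and_le i (fun M : Fin n → Fin n → Bool => n * sqDist M i < 1)
    (fun _ => True) ((1 / 2) ^ (n - i : ℕ)) (fun _ _ => Iff.rfl) fun M _ => ?_
  · simpa [unifProb] using h
  · refine le_trans (unifProb_mono fun b hb => ?_)
      (unifProb_forall_abs_inner_lt_le _ _ (le_finrank_rowPerp M i))
    intro u hu j _ hu1
    rw [sqDist_update] at hb
    rw [← sq_lt_one_iff_abs_lt_one]
    exact (inner_signVec_sq_le hu hu1 b).trans_lt hb

lemma unifProb_sqDist_lt_and_allPatterns_le {m : ℕ} (hm : m ≤ n) {R : Finset (Fin n)}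
    (i : Fin n) (hR : ∀ j ∈ R, j < i) :
    unifProb (fun M : Fin n → Fin n → Bool => 4 * n ^ 3 * sqDist M i < 1 ∧ AllPatterns R m M) ≤
      (m.choose (m / 2) : ℝ) / 2 ^ m := by
  have hn : (0 : ℝ) < n := by exact_mod_cast i.pos
  refine (unifProb_and_le i _ _ _ (fun M b => ?_) fun M hM => ?_).trans
    (mul_le_of_le_one_right (by positivity)
      ((unifProb_mono (q := fun _ => True) fun _ _ => trivial).trans (by simp [unifProb])))
  · refine forall₂_congr fun f τ => exists_congr fun j => and_congr_right fun hj => ?_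
    rw [Function.update_of_ne (hR j hj).ne]
  · have hU : rowPerp M i ≠ ⊥ := fun h => by
      have := finrank_rowPerp_pos M i
      rw [h] at this
      simp at this
    obtain ⟨u, hu, j, huj, hu1⟩ := exists_mem_sup_normalized hU
    have hcard := hM.le_card (u := u) (by simpa using hm) (fun k hk => by
      rw [real_inner_comm]
      exact Submodule.mem_orthogonal _ _ |>.1 hu _
        (Submodule.subset_span ⟨k, hR k hk, rfl⟩)) huj
    refine (unifProb_mono fun b hb => ?_).trans (unifProb_abs_inner_signVec_lt_le u hcard)
    rw [sqDist_update] at hb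
    have h := inner_signVec_sq_le hu hu1 b
    rw [Fintype.card_fin, lt_div_iff₀ (by positivity), ← abs_of_pos (show (0 : ℝ) < 2 * n by
      positivity), ← abs_mul, ← sq_lt_one_iff_abs_lt_one, mul_pow]
    calc _ ≤ n * ‖(rowPerp M i).starProjection (signVec b)‖ ^ 2 * (2 * (n : ℝ)) ^ 2 := by gcongr
      _ = 4 * n ^ 3 * ‖(rowPerp M i).starProjection (signVec b)‖ ^ 2 := by ring
      _ < 1 := hb

lemma expect_sqDist_div_sub_one_sq_le (i : Fin n) :
    𝔼 M : Fin n → Fin n → Bool, (sqDist M i / Module.finrank ℝ (rowPerp M i) - 1) ^ 2 ≤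
      2 / ((n - i : ℕ) : ℝ) := by
  rw [expect_resample _ i]
  refine (expect_le_expect (g := fun _ => 2 / ((n - i : ℕ) : ℝ)) fun M _ => ?_).trans
    (Fintype.expect_const _).le
  simp only [sqDist_update, finrank_rowPerp_update]
  set k := Module.finrank ℝ (rowPerp M i) with hk
  have hk0 : (0 : ℝ) < k := by exact_mod_cast finrank_rowPerp_pos M i
  have hki : ((n - i : ℕ) : ℝ) ≤ k := by exact_mod_cast le_finrank_rowPerp M i
  have hi0 : (0 : ℝ) < (n - i : ℕ) := by exact_mod_cast Nat.sub_pos_of_lt i.2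
  have h := expect_norm_starProjection_signVec_le (rowPerp M i)
  rw [← hk] at h
  calc _ = (𝔼 x : Fin n → Bool,
        (‖(rowPerp M i).starProjection (signVec x)‖ ^ 2 - k) ^ 2) / (k : ℝ) ^ 2 := by
        rw [expect_div]
        refine expect_congr rfl fun x _ => ?_
        field_simp
    _ ≤ 2 * k / (k : ℝ) ^ 2 := by gcongr
    _ = 2 / k := by field_simp
    _ ≤ _ := by gcongr

end Distances

section Analysis

open Finset

lemma neg_log_le_add_mul_sq {t a Λ : ℝ} (ht : 0 < t) (ha : 0 < a) (hΛ : 0 ≤ Λ)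
    (htΛ : -Real.log t ≤ Λ) : -Real.log t ≤ a⁻¹ + (a + 4 * Λ) * (t - 1) ^ 2 := by
  rcases le_or_gt (1 / 2) t with h | h
  · have h1 := Real.one_sub_inv_le_log_of_pos ht
    have h2 : t⁻¹ - 1 ≤ 2 * |t - 1| := by
      have h3 : t⁻¹ ≤ 2 := by
        rw [inv_le_comm₀ ht two_pos]; linarith
      have h4 : t⁻¹ - 1 = t⁻¹ * (1 - t) := by field_simp
      rw [h4]
      calc t⁻¹ * (1 - t) ≤ t⁻¹ * |t - 1| := by
            gcongr
            rw [abs_sub_comm]; exact le_abs_self _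
        _ ≤ 2 * |t - 1| := by gcongr
    have h5 : 2 * |t - 1| ≤ a⁻¹ + a * (t - 1) ^ 2 := by
      have h6 : a⁻¹ + a * |t - 1| ^ 2 - 2 * |t - 1| = a * (|t - 1| - a⁻¹) ^ 2 := by
        field_simp; ring
      have h7 : 0 ≤ a * (|t - 1| - a⁻¹) ^ 2 := by positivity
      rw [← sq_abs]
      linarith
    have h8 : 0 ≤ 4 * Λ * (t - 1) ^ 2 := by positivity
    linarith
  · have h1 : 1 / 4 ≤ (t - 1) ^ 2 := by nlinarith
    have h2 : 4 * Λ * (1 / 4) ≤ 4 * Λ * (t - 1) ^ 2 := by gcongr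
    have h3 : 0 ≤ a * (t - 1) ^ 2 := by positivity
    have h4 : 0 < a⁻¹ := by positivity
    linarith

lemma sum_range_inv_sqrt_le (n : ℕ) :
    ∑ k ∈ range n, (√((k + 1 : ℕ) : ℝ))⁻¹ ≤ 2 * √(n : ℝ) := by
  induction n with
  | zero => simp
  | succ n ih =>
    rw [sum_range_succ]
    set a := √(n : ℝ)
    set b := √((n + 1 : ℕ) : ℝ) with hb
    have hb0 : 0 < b := Real.sqrt_pos.2 (by positivity)
    have ha0 : 0 ≤ a := Real.sqrt_nonneg _
    have ha2 : a ^ 2 = n := Real.sq_sqrt (by positivity)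
    have hb2 : b ^ 2 = n + 1 := by
      rw [hb, Real.sq_sqrt (by positivity)]; push_cast; ring
    have h : b⁻¹ ≤ 2 * b - 2 * a := by
      rw [inv_le_iff_one_le_mul₀ hb0]
      nlinarith [sq_nonneg (b - a)]
    linarith

lemma sum_range_inv_le (n : ℕ) :
    ∑ k ∈ range n, (((k + 1 : ℕ) : ℝ))⁻¹ ≤ 1 + Real.log n := by
  have h := harmonic_le_one_add_log n
  simpa [harmonic] using h

lemma sum_fin_sub_eq (n : ℕ) (f : ℕ → ℝ) :
    ∑ i : Fin n, f (n - i) = ∑ k ∈ range n, f (k + 1) := by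
  rw [Fin.sum_univ_eq_sum_range (fun i => f (n - i)), ← sum_range_reflect]
  refine sum_congr rfl fun k hk => ?_
  have := mem_range.1 hk
  congr 1
  omega

lemma prod_fin_sub_eq_factorial (n : ℕ) : ∏ i : Fin n, ((n - i : ℕ) : ℝ) = n.factorial := by
  rw [Fin.prod_univ_eq_prod_range (fun i => ((n - i : ℕ) : ℝ)), ← prod_range_reflect,
    ← prod_range_add_one_eq_factorial, Nat.cast_prod]
  refine prod_congr rfl fun k hk => ?_
  have := mem_range.1 hk
  congr 1
  omega

lemma sum_range_half_pow_le {N r : ℕ} (hr : r ≤ N) :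
    ∑ i ∈ range r, (1 / 2 : ℝ) ^ (N - i) ≤ (1 / 2) ^ (N - r) := by
  induction r with
  | zero => simp
  | succ r ih =>
    rw [sum_range_succ]
    have h := ih (by omega)
    have h2 : N - r = (N - (r + 1)) + 1 := by omega
    rw [h2, pow_succ] at h ⊢
    linarith

lemma centralBinom_div_le (l : ℕ) :
    ((2 * l).choose (2 * l / 2) : ℝ) / 2 ^ (2 * l) ≤ 1 / √(2 * l + 1) := by
  have h : ∀ l : ℕ, (2 * l + 1) * l.centralBinom ^ 2 ≤ 16 ^ l := fun l => by
    induction l with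
    | zero => simp
    | succ l ih =>
      have h1 := Nat.succ_mul_centralBinom_succ l
      have h2 : (l + 1) ^ 2 * ((2 * (l + 1) + 1) * (l + 1).centralBinom ^ 2) ≤
          (l + 1) ^ 2 * 16 ^ (l + 1) := by
        calc _ = (2 * l + 3) * ((l + 1) * (l + 1).centralBinom) ^ 2 := by ring
          _ = 4 * ((2 * l + 3) * (2 * l + 1)) * ((2 * l + 1) * l.centralBinom ^ 2) := by
            rw [h1]; ring
          _ ≤ 4 * (4 * (l + 1) ^ 2) * 16 ^ l := by
            exact Nat.mul_le_mul (Nat.mul_le_mul_left 4 (by nlinarith)) ih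
          _ = _ := by ring
      exact Nat.le_of_mul_le_mul_left h2 (by positivity)
  rw [Nat.mul_div_cancel_left _ two_pos, ← Nat.centralBinom_eq_two_mul_choose,
    div_le_div_iff₀ (by positivity) (by positivity), one_mul]
  refine le_of_sq_le_sq ?_ (by positivity)
  rw [mul_pow, Real.sq_sqrt (by positivity), ← pow_mul, mul_comm]
  have : (2 : ℝ) ^ (2 * l * 2) = 16 ^ l := by
    rw [show 2 * l * 2 = 4 * l by ring, pow_mul]; norm_num
  rw [this]
  exact_mod_cast h l

end Analysis

section Combination

open Finset
open scoped BigOperators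

/-- The weighted sum of squared relative fluctuations of the squared distances. -/
noncomputable def fluctuation {n : ℕ} (M : Fin n → Fin n → Bool) : ℝ :=
  ∑ i : Fin n, (√((n - i : ℕ) : ℝ) + 4 * Real.log (4 * n ^ 4)) *
    (sqDist M i / Module.finrank ℝ (rowPerp M i) - 1) ^ 2

lemma log_four_mul_pow_nonneg (n : ℕ) : 0 ≤ Real.log (4 * (n : ℝ) ^ 4) := by
  have : (4 * (n : ℝ) ^ 4) = ((4 * n ^ 4 : ℕ) : ℝ) := by push_cast; ring
  rw [this]
  exact Real.log_natCast_nonneg _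

lemma fluctuation_nonneg {n : ℕ} (M : Fin n → Fin n → Bool) : 0 ≤ fluctuation M :=
  sum_nonneg fun i _ => mul_nonneg
    (add_nonneg (Real.sqrt_nonneg _) (mul_nonneg (by norm_num) (log_four_mul_pow_nonneg n)))
    (sq_nonneg _)

lemma expect_fluctuation_le (n : ℕ) :
    𝔼 M : Fin n → Fin n → Bool, fluctuation M ≤
      4 * √(n : ℝ) + 8 * Real.log (4 * n ^ 4) * (1 + Real.log n) := by
  set Λ := Real.log (4 * (n : ℝ) ^ 4) with hΛ
  have hΛ0 : 0 ≤ Λ := log_four_mul_pow_nonneg n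
  simp only [fluctuation, expect_sum_comm, ← mul_expect]
  calc _ ≤ ∑ i : Fin n, (√((n - i : ℕ) : ℝ) + 4 * Λ) * (2 / ((n - i : ℕ) : ℝ)) := by
        refine sum_le_sum fun i _ => ?_
        gcongr
        exact expect_sqDist_div_sub_one_sq_le i
    _ = 2 * ∑ k ∈ range n, (√((k + 1 : ℕ) : ℝ))⁻¹ +
        8 * Λ * ∑ k ∈ range n, (((k + 1 : ℕ) : ℝ))⁻¹ := by
        rw [sum_fin_sub_eq n fun k => (√(k : ℝ) + 4 * Λ) * (2 / (k : ℝ)), mul_sum, mul_sum,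
          ← sum_add_distrib]
        refine sum_congr rfl fun k _ => ?_
        have h0 : (0 : ℝ) < (k + 1 : ℕ) := by positivity
        have h1 : √((k + 1 : ℕ) : ℝ) / ((k + 1 : ℕ) : ℝ) = (√((k + 1 : ℕ) : ℝ))⁻¹ := by
          rw [Real.sqrt_div_self', one_div]
        rw [← h1]
        ring
    _ ≤ 2 * (2 * √(n : ℝ)) + 8 * Λ * (1 + Real.log n) := by
        gcongr
        · exact sum_range_inv_sqrt_le n
        · exact sum_range_inv_le n
    _ = _ := by ring

lemma sqrt_factorial_mul_exp_le_abs_det {n : ℕ} (M : Fin n → Fin n → Bool) {T : ℝ}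
    (hd : ∀ i, 1 ≤ 4 * n ^ 3 * sqDist M i) (hT : fluctuation M ≤ T) :
    √(n.factorial : ℝ) * Real.exp (-(2 * √(n : ℝ) + T) / 2) ≤
      |(Matrix.of fun i j => if M i j then (1 : ℝ) else -1).det| := by
  set Λ := Real.log (4 * (n : ℝ) ^ 4) with hΛ
  set w : Fin n → ℝ := fun i => (√((n - i : ℕ) : ℝ))⁻¹ + (√((n - i : ℕ) : ℝ) + 4 * Λ) *
    (sqDist M i / Module.finrank ℝ (rowPerp M i) - 1) ^ 2 with hw
  have hrow : ∀ i : Fin n, ((n - i : ℕ) : ℝ) * Real.exp (-w i) ≤ sqDist M i := fun i => by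
    have hn : (0 : ℝ) < n := by exact_mod_cast i.pos
    set k := Module.finrank ℝ (rowPerp M i) with hk
    have hk0 : (0 : ℝ) < k := by exact_mod_cast finrank_rowPerp_pos M i
    have hki : ((n - i : ℕ) : ℝ) ≤ k := by exact_mod_cast le_finrank_rowPerp M i
    have hkn : (k : ℝ) ≤ n := by exact_mod_cast finrank_rowPerp_le M i
    have hi0 : (0 : ℝ) < (n - i : ℕ) := by exact_mod_cast Nat.sub_pos_of_lt i.2
    have hD : 0 < sqDist M i := by
      have : 0 < 4 * (n : ℝ) ^ 3 * sqDist M i := one_pos.trans_le (hd i)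
      exact (pos_iff_pos_of_mul_pos this).1 (by positivity)
    have ht : 0 < sqDist M i / k := div_pos hD hk0
    have htΛ : -Real.log (sqDist M i / k) ≤ Λ := by
      rw [← Real.log_inv]
      refine Real.log_le_log (inv_pos.2 ht) ?_
      rw [inv_div, div_le_iff₀ hD]
      calc (k : ℝ) ≤ n * 1 := by linarith
        _ ≤ n * (4 * n ^ 3 * sqDist M i) := by gcongr; exact hd i
        _ = _ := by ring
    have h := neg_log_le_add_mul_sq ht (Real.sqrt_pos.2 hi0) (log_four_mul_pow_nonneg n) htΛ
    have hexp : Real.exp (-w i) ≤ sqDist M i / k := by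
      rw [← Real.exp_log ht]
      exact Real.exp_le_exp.2 (by linarith)
    calc _ ≤ (k : ℝ) * (sqDist M i / k) := by gcongr
      _ = sqDist M i := by field_simp
  have hsum : ∑ i, w i ≤ 2 * √(n : ℝ) + T := by
    rw [hw, sum_add_distrib, sum_fin_sub_eq n fun k => (√(k : ℝ))⁻¹]
    exact add_le_add (sum_range_inv_sqrt_le n) hT
  rw [← Real.sqrt_sq_eq_abs, det_sq_eq_prod_sqDist]
  have hexp : Real.exp (-(2 * √(n : ℝ) + T) / 2) = √(Real.exp (-(2 * √(n : ℝ) + T))) := by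
    rw [Real.exp_half]
  rw [hexp, ← Real.sqrt_mul (by positivity)]
  refine Real.sqrt_le_sqrt ?_
  calc _ ≤ (n.factorial : ℝ) * Real.exp (-∑ i, w i) := by gcongr
    _ = ∏ i : Fin n, (((n - i : ℕ) : ℝ) * Real.exp (-w i)) := by
      rw [prod_mul_distrib, prod_fin_sub_eq_factorial, ← Real.exp_sum, sum_neg_distrib]
    _ ≤ _ := prod_le_prod (fun i _ => by positivity) fun i _ => hrow i

lemma unifProb_exists_sqDist_lt_le {n K l : ℕ} (hKn : K ≤ n) (hl : 2 * l ≤ n) :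
    unifProb (fun M : Fin n → Fin n → Bool => ∃ i, 4 * n ^ 3 * sqDist M i < 1) ≤
      (1 / 2) ^ K + K / √(2 * l + 1) +
        (n : ℝ) ^ (2 * l) * 2 ^ (2 * l) * (1 - (1 / 2) ^ (2 * l)) ^ (n - K) := by
  classical
  set R : Finset (Fin n) := univ.filter fun j => (j : ℕ) < n - K with hR
  have hRcard : #R = n - K := by
    rw [hR, Fin.card_filter_val_lt, min_eq_right (Nat.sub_le _ _)]
  have hRc : #Rᶜ = K := by
    rw [card_compl, hRcard, Fintype.card_fin]; omega
  have hone : unifProb (fun M : Fin n → Fin n → Bool => ∃ i ∈ R, n * sqDist M i < 1) ≤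
      (1 / 2) ^ K := by
    refine (unifProb_exists_le _ _).trans ((sum_le_sum fun i _ => unifProb_sqDist_lt_le i).trans ?_)
    calc ∑ i ∈ R, (1 / 2 : ℝ) ^ (n - i : ℕ)
        = ∑ i ∈ range (n - K), (1 / 2 : ℝ) ^ (n - i) := by
          rw [hR, sum_filter, Fin.sum_univ_eq_sum_range
            (fun i => if i < n - K then (1 / 2 : ℝ) ^ (n - i) else 0), ← sum_filter]
          congr 1
          ext i
          simp only [mem_filter, mem_range]
          omega
      _ ≤ (1 / 2) ^ (n - (n - K)) := sum_range_half_pow_le (Nat.sub_le _ _)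
      _ = (1 / 2) ^ K := by congr 1; omega
  have htwo : unifProb (fun M : Fin n → Fin n → Bool => ∃ i ∈ Rᶜ,
      4 * n ^ 3 * sqDist M i < 1 ∧ AllPatterns R (2 * l) M) ≤ K / √(2 * l + 1) := by
    refine (unifProb_exists_le _ _).trans ?_
    calc _ ≤ ∑ _i ∈ Rᶜ, 1 / √(2 * l + 1) := by
          refine sum_le_sum fun i hi => ?_
          refine (unifProb_sqDist_lt_and_allPatterns_le hl i fun j hj => ?_).trans
            (centralBinom_div_le l)
          simp only [hR, mem_compl, mem_filter, mem_univ, true_and] at hi hj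
          exact Fin.lt_def.2 (by omega)
      _ = K / √(2 * l + 1) := by rw [sum_const, hRc, nsmul_eq_mul, mul_one_div]
  have hthree := unifProb_not_allPatterns_le (ι := Fin n) R (2 * l)
  rw [hRcard, Fintype.card_fin] at hthree
  refine (unifProb_mono fun M hM => ?_).trans ((unifProb_or_le _ _).trans
    (add_le_add ((unifProb_or_le _ _).trans (add_le_add hone htwo)) hthree))
  obtain ⟨i, hi⟩ := hM
  by_cases hP : AllPatterns R (2 * l) M
  · left
    by_cases hiR : i ∈ R
    · left
      refine ⟨i, hiR, lt_of_le_of_lt ?_ hi⟩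
      have hn : (1 : ℝ) ≤ n := by exact_mod_cast i.pos
      have hD : 0 ≤ sqDist M i := sq_nonneg _
      gcongr
      nlinarith [mul_le_mul hn hn zero_le_one (by linarith), sq_nonneg (n : ℝ)]
    · right
      exact ⟨i, mem_compl.2 hiR, hi, hP⟩
  · right
    exact hP

end Combination

section Limit

open Finset
open scoped BigOperators

lemma tendsto_expect_fluctuation_bound :
    Tendsto (fun n : ℕ => (4 * √(n : ℝ) + 8 * Real.log (4 * n ^ 4) * (1 + Real.log n)) /
      (56 * √(n * Real.log n))) atTop (nhds 0) := by
  have hlog : Tendsto (fun n : ℕ => Real.log n) atTop atTop :=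
    Real.tendsto_log_atTop.comp tendsto_natCast_atTop_atTop
  have h1 : Tendsto (fun n : ℕ => (√(Real.log n))⁻¹) atTop (nhds 0) :=
    tendsto_inv_atTop_zero.comp (Real.tendsto_sqrt_atTop.comp hlog)
  have h2 : Tendsto (fun n : ℕ => Real.log n ^ 2 / √(n : ℝ)) atTop (nhds 0) := by
    have h := (isLittleO_log_rpow_rpow_atTop 2
      (show (0 : ℝ) < 1 / 2 by norm_num)).tendsto_div_nhds_zero
    refine (h.comp tendsto_natCast_atTop_atTop).congr fun n => ?_
    simp [Real.sqrt_eq_rpow]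
  have h3 : Tendsto (fun n : ℕ => (√(Real.log n))⁻¹ + 2 * (Real.log n ^ 2 / √(n : ℝ)))
      atTop (nhds 0) := by
    simpa using h1.add (h2.const_mul 2)
  refine squeeze_zero' (Eventually.of_forall fun n => ?_) ?_ h3
  · have := log_four_mul_pow_nonneg n
    have := Real.log_natCast_nonneg n
    positivity
  · filter_upwards [hlog.eventually_ge_atTop 1, eventually_gt_atTop 0] with n hL hn
    have hn0 : (0 : ℝ) < n := by exact_mod_cast hn
    set L := Real.log n with hLdef
    have hΛ : Real.log (4 * (n : ℝ) ^ 4) ≤ 6 * L := by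
      have h4 : Real.log 4 ≤ 2 := by
        rw [show (4 : ℝ) = 2 ^ 2 by norm_num, Real.log_pow]
        have := Real.log_two_lt_d9
        push_cast
        linarith
      rw [Real.log_mul (by norm_num) (by positivity), Real.log_pow]
      push_cast
      linarith
    have hL0 : 0 < L := by linarith
    have hs1 : 1 ≤ √L := Real.one_le_sqrt.2 hL
    have hs0 : 0 < √(n : ℝ) := Real.sqrt_pos.2 hn0
    rw [Real.sqrt_mul hn0.le, div_le_iff₀ (by positivity)]
    have hprod : Real.log (4 * (n : ℝ) ^ 4) * (1 + L) ≤ 6 * L * (2 * L) := by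
      gcongr
      linarith
    have hsL : L ^ 2 ≤ L ^ 2 * √L := le_mul_of_one_le_right (by positivity) hs1
    have heq : ((√L)⁻¹ + 2 * (L ^ 2 / √(n : ℝ))) * (56 * (√(n : ℝ) * √L)) =
        56 * √(n : ℝ) + 112 * (L ^ 2 * √L) := by
      field_simp
      ring
    rw [heq]
    nlinarith

lemma tendsto_pow_mul_pow_sub {q : ℝ} (hq0 : 0 < q) (hq1 : q < 1) (m K : ℕ) :
    Tendsto (fun n : ℕ => (n : ℝ) ^ m * 2 ^ m * q ^ (n - K)) atTop (nhds 0) := by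
  have h := (tendsto_pow_const_mul_const_pow_of_abs_lt_one m
    (show |q| < 1 by rwa [abs_of_pos hq0])).const_mul (2 ^ m * (q ^ K)⁻¹)
  rw [mul_zero] at h
  refine h.congr' ?_
  filter_upwards [eventually_ge_atTop K] with n hn
  rw [pow_sub₀ q hq0.ne' hn]
  ring

lemma tendsto_unifProb_exists_sqDist_lt :
    Tendsto (fun n : ℕ => unifProb fun M : Fin n → Fin n → Bool =>
      ∃ i, 4 * n ^ 3 * sqDist M i < 1) atTop (nhds 0) := by
  rw [tendsto_order]
  refine ⟨fun a ha => Eventually.of_forall fun n => ha.trans_le (unifProb_nonneg _),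
    fun ε hε => ?_⟩
  obtain ⟨K, hK⟩ := exists_pow_lt_of_lt_one (show 0 < ε / 3 by positivity)
    (show (1 / 2 : ℝ) < 1 by norm_num)
  have hsqrt : Tendsto (fun l : ℕ => (K : ℝ) / √(2 * l + 1)) atTop (nhds 0) := by
    refine tendsto_const_nhds.div_atTop (Real.tendsto_sqrt_atTop.comp ?_)
    exact tendsto_atTop_add_const_right _ _
      (tendsto_natCast_atTop_atTop.const_mul_atTop two_pos)
  obtain ⟨l, hl, hl1⟩ := ((hsqrt.eventually_lt_const (show 0 < ε / 3 by positivity)).and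
    (eventually_ge_atTop 1)).exists
  have hq : (1 / 2 : ℝ) ^ (2 * l) < 1 := pow_lt_one₀ (by norm_num) (by norm_num) (by omega)
  have hq' : (0 : ℝ) < (1 / 2) ^ (2 * l) := by positivity
  have h := tendsto_pow_mul_pow_sub (sub_pos.2 hq) (sub_lt_self 1 hq') (2 * l) K
  filter_upwards [h.eventually_lt_const (show 0 < ε / 3 by positivity),
    eventually_ge_atTop K, eventually_ge_atTop (2 * l)] with n hn hKn hln
  have := unifProb_exists_sqDist_lt_le hKn hln
  linarith

lemma tendsto_unifProb_le_fluctuation :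
    Tendsto (fun n : ℕ => unifProb fun M : Fin n → Fin n → Bool =>
      56 * √(n * Real.log n) ≤ fluctuation M) atTop (nhds 0) := by
  refine squeeze_zero' (Eventually.of_forall fun n => unifProb_nonneg _) ?_
    tendsto_expect_fluctuation_bound
  filter_upwards [eventually_gt_atTop 1] with n hn
  have hn1 : (1 : ℝ) < n := by exact_mod_cast hn
  have hc : 0 < 56 * √(n * Real.log n) := by
    have := Real.log_pos hn1
    positivity
  refine (unifProb_markov _ fluctuation_nonneg hc).trans ?_
  gcongr
  exact expect_fluctuation_le n

lemma tendsto_unifProb_sqrt_factorial_mul_exp_le_abs_det :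
    Tendsto (fun n : ℕ => unifProb fun M : Fin n → Fin n → Bool =>
      √(n.factorial : ℝ) * Real.exp (-29 * √(n * Real.log n)) ≤
        |(Matrix.of fun i j => if M i j then (1 : ℝ) else -1).det|) atTop (nhds 1) := by
  have h := (tendsto_unifProb_le_fluctuation.add tendsto_unifProb_exists_sqDist_lt).const_sub 1
  rw [add_zero, sub_zero] at h
  refine tendsto_of_tendsto_of_tendsto_of_le_of_le' h tendsto_const_nhds ?_
    (Eventually.of_forall fun n => ?_)
  · have hlog : Tendsto (fun n : ℕ => Real.log n) atTop atTop :=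
      Real.tendsto_log_atTop.comp tendsto_natCast_atTop_atTop
    filter_upwards [hlog.eventually_ge_atTop 1] with n hL
    have hle := (unifProb_mono (p := fun M : Fin n → Fin n → Bool =>
      ¬ √(n.factorial : ℝ) * Real.exp (-29 * √(n * Real.log n)) ≤
        |(Matrix.of fun i j => if M i j then (1 : ℝ) else -1).det|) fun M hM => ?_).trans
      (unifProb_or_le (fun M => 56 * √(n * Real.log n) ≤ fluctuation M)
        (fun M : Fin n → Fin n → Bool => ∃ i, 4 * n ^ 3 * sqDist M i < 1))
    · rw [unifProb_not] at hle
      linarith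
    · by_contra! hcon
      refine hM (le_trans ?_ (sqrt_factorial_mul_exp_le_abs_det M hcon.2 hcon.1.le))
      have hs : √(n : ℝ) ≤ √(n * Real.log n) :=
        Real.sqrt_le_sqrt (le_mul_of_one_le_right (by positivity) hL)
      gcongr
      linarith
  · have := unifProb_nonneg fun M : Fin n → Fin n → Bool =>
      ¬ √(n.factorial : ℝ) * Real.exp (-29 * √(n * Real.log n)) ≤
        |(Matrix.of fun i j => if M i j then (1 : ℝ) else -1).det|
    rw [unifProb_not] at this
    linarith

end Limit

/-- **Tao–Vu determinant theorem.** For the `n × n` random matrix `M n` with i.i.d.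
uniform `±1` entries (modeled by a uniform `s : Fin n → Fin n → Bool`), the probability
that `|det Mₙ| ≥ √(n!) · exp(-29 √(n log n))` tends to `1` as `n → ∞`. -/
theorem det_lower_bound_asymptotically_almost_surely :
    Tendsto (fun n : ℕ =>
        (Nat.card {s : Fin n → Fin n → Bool //
            Real.sqrt (n.factorial) * Real.exp (-29 * Real.sqrt (n * Real.log n)) ≤
              |(Matrix.of fun i j => if s i j then (1 : ℝ) else -1).det|} : ℝ) / 2 ^ (n * n))
      atTop (nhds 1) := by
  refine tendsto_unifProb_sqrt_factorial_mul_exp_le_abs_det.congr fun n => ?_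
  rw [unifProb_eq]
  congr 1
  simp [pow_mul]
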